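/- arXiv:math/0607067 — 4 statements merged into one kernel-verified Lean document; each statement's English description precedes it below -/
import Mathlib

section
/- (Relative Convexity Lemma) Let P and Q be continuous real-valued functions on a finite interval [a,b] with Q(x) ≤ P(x) for all x. Let u and v be the solutions of u'' + P·u = 0 and v'' + Q·v = 0 with u(a) = v(a) = 1 and u'(a) = v'(a) = 0, and suppose u(x) > 0 and v(x) > 0 on [a,b). Define F(x) = ∫_a^x v(t)^{−2} dt for a ≤ x < b; then F is continuous and strictly increasing, mapping [a,b) onto an interval [0,L) with 0 < L ≤ ∞. Let G denote the inverse of F. Then the function w(y) = u(G(y))/v(G(y)) is concave on [0,L). -/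
open Set

theorem concaveOn_comp_leftInvOn_of_hasDerivAt_mul {a b : ℝ} {F F' g W G : ℝ → ℝ}
    (hFc : ContinuousOn F (Ico a b)) (hFm : StrictMonoOn F (Ico a b))
    (hgc : ContinuousOn g (Ico a b))
    (hF : ∀ x ∈ Ioo a b, HasDerivAt F (F' x) x)
    (hg : ∀ x ∈ Ioo a b, HasDerivAt g (W x * F' x) x)
    (hF' : ∀ x ∈ Ioo a b, F' x ≠ 0) (hW : AntitoneOn W (Icc a b))
    (hG : LeftInvOn G F (Ico a b)) :
    ConcaveOn ℝ (F '' Ico a b) (g ∘ G) := by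
  have slope_eq : ∀ x ∈ Ico a b, ∀ y ∈ Ico a b, x < y →
      ∃ c ∈ Ioo x y, (g y - g x) / (F y - F x) = W c := by
    intro x hx y hy hxy
    have hsub : Icc x y ⊆ Ico a b := fun t ht => ⟨hx.1.trans ht.1, ht.2.trans_lt hy.2⟩
    have hsub' : Ioo x y ⊆ Ioo a b := Ioo_subset_Ioo hx.1 hy.2.le
    obtain ⟨c, hc, h⟩ := exists_ratio_hasDerivAt_eq_ratio_slope F F' hxy (hFc.mono hsub)
      (fun t ht => hF t (hsub' ht)) g (fun t => W t * F' t) (hgc.mono hsub)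
      (fun t ht => hg t (hsub' ht))
    refine ⟨c, hc, ?_⟩
    have hpos : F y - F x ≠ 0 := (sub_pos.2 (hFm hx hy hxy)).ne'
    rw [div_eq_iff hpos]
    apply mul_right_cancel₀ (hF' c (hsub' hc))
    linarith
  refine concaveOn_of_slope_anti_adjacent
    (isPreconnected_Ico.image F hFc).ordConnected.convex ?_
  rintro _ y _ ⟨p, hp, rfl⟩ ⟨r, hr, rfl⟩ hxy hyz
  obtain ⟨q, hq, rfl⟩ : y ∈ F '' Ico a b :=
    (isPreconnected_Ico.image F hFc).ordConnected.out ⟨p, hp, rfl⟩ ⟨r, hr, rfl⟩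
      ⟨hxy.le, hyz.le⟩
  have hpq := (hFm.lt_iff_lt hp hq).1 hxy
  have hqr := (hFm.lt_iff_lt hq hr).1 hyz
  obtain ⟨c, hc, h₁⟩ := slope_eq p hp q hq hpq
  obtain ⟨d, hd, h₂⟩ := slope_eq q hq r hr hqr
  simp only [Function.comp, hG hp, hG hq, hG hr]
  rw [h₁, h₂]
  exact hW ⟨hp.1.trans hc.1.le, hc.2.le.trans hq.2.le⟩
    ⟨hq.1.trans hd.1.le, hd.2.le.trans hr.2.le⟩ (hc.2.trans hd.1).le

theorem StrictMonoOn.exists_image_Ico_eq {a b : ℝ} {F : ℝ → ℝ} (hab : a < b)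
    (hFc : ContinuousOn F (Ico a b)) (hFm : StrictMonoOn F (Ico a b)) :
    ∃ L : EReal, (F a : EReal) < L ∧
      F '' Ico a b = {y : ℝ | F a ≤ y ∧ (y : EReal) < L} := by
  have ha : a ∈ Ico a b := ⟨le_rfl, hab⟩
  have lt_sup : ∀ x ∈ Ico a b, (F x : EReal) < ⨆ t ∈ Ico a b, (F t : EReal) := by
    intro x hx
    obtain ⟨c, hxc, hcb⟩ := exists_between hx.2
    have hc : c ∈ Ico a b := ⟨hx.1.trans hxc.le, hcb⟩
    exact (EReal.coe_lt_coe_iff.2 (hFm hx hc hxc)).trans_le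
      (le_iSup₂ (f := fun t (_ : t ∈ Ico a b) => (F t : EReal)) c hc)
  refine ⟨_, lt_sup a ha, Subset.antisymm ?_ ?_⟩
  · rintro _ ⟨x, hx, rfl⟩
    exact ⟨hFm.monotoneOn ha hx hx.1, lt_sup x hx⟩
  · rintro y ⟨hy, hyL⟩
    simp only [lt_iSup_iff] at hyL
    obtain ⟨x, hx, hyx⟩ := hyL
    exact (isPreconnected_Ico.image F hFc).ordConnected.out ⟨a, ha, rfl⟩ ⟨x, hx, rfl⟩
      ⟨hy, (EReal.coe_lt_coe_iff.1 hyx).le⟩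

theorem ContinuousOn.continuousOn_Ico_integral {a b : ℝ} {f : ℝ → ℝ}
    (hf : ContinuousOn f (Ico a b)) :
    ContinuousOn (fun x => ∫ t in a..x, f t) (Ico a b) := by
  intro x hx
  obtain ⟨c, hxc, hcb⟩ := exists_between hx.2
  have hac : a ≤ c := hx.1.trans hxc.le
  have hint : MeasureTheory.IntegrableOn f (uIcc a c) := by
    rw [uIcc_of_le hac]
    exact (hf.mono fun t ht => ⟨ht.1, ht.2.trans_lt hcb⟩).integrableOn_Icc
  have h := intervalIntegral.continuousOn_primitive_interval hint
  rw [uIcc_of_le hac] at h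
  refine (h x ⟨hx.1, hxc.le⟩).mono_of_mem_nhdsWithin ?_
  filter_upwards [self_mem_nhdsWithin, mem_nhdsWithin_of_mem_nhds (Iio_mem_nhds hxc)]
    with t ht htc using ⟨ht.1, le_of_lt htc⟩

theorem ContinuousOn.hasDerivAt_integral_of_mem_Ioo {a b x : ℝ} {f : ℝ → ℝ}
    (hf : ContinuousOn f (Ico a b)) (hx : x ∈ Ioo a b) :
    HasDerivAt (fun x => ∫ t in a..x, f t) (f x) x := by
  have hfo := hf.mono Ioo_subset_Ico_self
  refine intervalIntegral.integral_hasDerivAt_right ?_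
    (hfo.stronglyMeasurableAtFilter isOpen_Ioo x hx) (hfo.continuousAt (Ioo_mem_nhds hx.1 hx.2))
  refine (hf.mono ?_).intervalIntegrable
  rw [uIcc_of_le hx.1.le]
  exact fun t ht => ⟨ht.1, ht.2.trans_lt hx.2⟩

/-- Relative Convexity Lemma: let `P`, `Q` be continuous on `[a,b]` with `Q ≤ P`, let
`u`, `v` solve `u'' + Pu = 0`, `v'' + Qv = 0` with `u(a) = v(a) = 1`, `u'(a) = v'(a) = 0`,
and suppose `u > 0`, `v > 0` on `[a,b)`.  With `F(x) = ∫_a^x v(t)⁻² dt`, the function `F`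
is continuous and strictly increasing on `[a,b)`, mapping it onto an interval `[0,L)` with
`0 < L ≤ ∞`, and for any inverse `G` of `F` the function `w(y) = u(G(y))/v(G(y))`
is concave on `[0,L)`. -/
theorem stmt3 (a b : ℝ) (hab : a < b) (P Q u v u' v' : ℝ → ℝ)
    (hP : ContinuousOn P (Icc a b)) (hQ : ContinuousOn Q (Icc a b))
    (hQP : ∀ x ∈ Icc a b, Q x ≤ P x)
    (hu1 : ∀ x ∈ Icc a b, HasDerivWithinAt u (u' x) (Icc a b) x)
    (hu2 : ∀ x ∈ Icc a b, HasDerivWithinAt u' (-(P x * u x)) (Icc a b) x)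
    (hv1 : ∀ x ∈ Icc a b, HasDerivWithinAt v (v' x) (Icc a b) x)
    (hv2 : ∀ x ∈ Icc a b, HasDerivWithinAt v' (-(Q x * v x)) (Icc a b) x)
    (hua : u a = 1) (hva : v a = 1) (hu'a : u' a = 0) (hv'a : v' a = 0)
    (hupos : ∀ x ∈ Ico a b, 0 < u x) (hvpos : ∀ x ∈ Ico a b, 0 < v x)
    (F : ℝ → ℝ) (hF : ∀ x ∈ Ico a b, F x = ∫ t in a..x, (v t ^ 2)⁻¹) :
    ContinuousOn F (Ico a b) ∧ StrictMonoOn F (Ico a b) ∧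
    ∃ L : EReal, 0 < L ∧
      F '' Ico a b = {y : ℝ | 0 ≤ y ∧ (y : EReal) < L} ∧
      ∀ G : ℝ → ℝ, (∀ x ∈ Ico a b, G (F x) = x) →
        ConcaveOn ℝ (F '' Ico a b) (fun y => u (G y) / v (G y)) := by
  have ha : a ∈ Ico a b := ⟨le_rfl, hab⟩
  have hv0 : ∀ x ∈ Ico a b, v x ≠ 0 := fun x hx => (hvpos x hx).ne'
  have huc : ContinuousOn u (Icc a b) := fun x hx => (hu1 x hx).continuousWithinAt
  have hvc : ContinuousOn v (Icc a b) := fun x hx => (hv1 x hx).continuousWithinAt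
  have hfc : ContinuousOn (fun t => (v t ^ 2)⁻¹) (Ico a b) :=
    ((hvc.mono Ico_subset_Icc_self).pow 2).inv₀ fun x hx => pow_ne_zero 2 (hv0 x hx)
  have hFc : ContinuousOn F (Ico a b) := hfc.continuousOn_Ico_integral.congr hF
  have hFd : ∀ x ∈ Ioo a b, HasDerivAt F ((v x ^ 2)⁻¹) x := fun x hx =>
    (hfc.hasDerivAt_integral_of_mem_Ioo hx).congr_of_eventuallyEq <| by
      filter_upwards [Ioo_mem_nhds hx.1 hx.2] with t ht using hF t (Ioo_subset_Ico_self ht)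
  have hf0 : ∀ x ∈ Ioo a b, 0 < (v x ^ 2)⁻¹ := fun x hx =>
    inv_pos.2 (pow_pos (hvpos x (Ioo_subset_Ico_self hx)) 2)
  have hFm : StrictMonoOn F (Ico a b) := by
    refine strictMonoOn_of_deriv_pos (convex_Ico a b) hFc fun x hx => ?_
    rw [interior_Ico] at hx
    rw [(hFd x hx).deriv]
    exact hf0 x hx
  have hFa : F a = 0 := by rw [hF a ha, intervalIntegral.integral_same]
  obtain ⟨L, hL, himage⟩ := hFm.exists_image_Ico_eq hab hFc
  rw [hFa] at hL himage
  refine ⟨hFc, hFm, L, mod_cast hL, himage, fun G hG => ?_⟩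
  have hWd : ∀ x ∈ Icc a b, HasDerivWithinAt (fun t => u' t * v t - u t * v' t)
      ((Q x - P x) * (u x * v x)) (Icc a b) x := fun x hx =>
    (((hu2 x hx).mul (hv1 x hx)).sub ((hu1 x hx).mul (hv2 x hx))).congr_deriv (by ring)
  have hW : AntitoneOn (fun t => u' t * v t - u t * v' t) (Icc a b) := by
    refine antitoneOn_of_hasDerivWithinAt_nonpos (convex_Icc a b)
      (f' := fun x => (Q x - P x) * (u x * v x))
      (fun x hx => (hWd x hx).continuousWithinAt)
      (fun x hx => (hWd x (interior_subset hx)).mono interior_subset) fun x hx => ?_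
    rw [interior_Icc] at hx
    have hx' := Ioo_subset_Ico_self hx
    exact mul_nonpos_of_nonpos_of_nonneg
      (sub_nonpos.2 (hQP x (Ioo_subset_Icc_self hx))) (mul_pos (hupos x hx') (hvpos x hx')).le
  refine concaveOn_comp_leftInvOn_of_hasDerivAt_mul (g := fun x => u x / v x) hFc hFm
    ((huc.mono Ico_subset_Icc_self).div (hvc.mono Ico_subset_Icc_self) hv0) hFd
    (fun x hx => ?_) (fun x hx => (hf0 x hx).ne') hW hG
  have hxI := Ioo_subset_Icc_self hx
  have hn := Icc_mem_nhds hx.1 hx.2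
  rw [← div_eq_mul_inv]
  exact ((hu1 x hxI).hasDerivAt hn).div ((hv1 x hxI).hasDerivAt hn) (hv0 x (Ioo_subset_Ico_self hx))
end

section
/- Let p be a Nehari function. Then the limit μ = lim_{x→1⁻} (1−x²)²·p(x) exists and satisfies 0 ≤ μ ≤ 1. -/
open Set Filter

/-- A Nehari function: a positive continuous even function `p` on `(−1,1)` such that
`(1−x²)²·p(x)` is nonincreasing on `[0,1)` and no nontrivial real solution of
`u'' + p·u = 0` has more than one zero in `(−1,1)`. -/
def IsNehariFunction (p : ℝ → ℝ) : Prop :=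
  ContinuousOn p (Set.Ioo (-1 : ℝ) 1) ∧
  (∀ x ∈ Set.Ioo (-1 : ℝ) 1, 0 < p x) ∧
  (∀ x ∈ Set.Ioo (-1 : ℝ) 1, p (-x) = p x) ∧
  AntitoneOn (fun x => (1 - x ^ 2) ^ 2 * p x) (Set.Ico (0 : ℝ) 1) ∧
  ∀ u u' : ℝ → ℝ,
    (∀ x ∈ Set.Ioo (-1 : ℝ) 1, HasDerivAt u (u' x) x) →
    (∀ x ∈ Set.Ioo (-1 : ℝ) 1, HasDerivAt u' (-(p x * u x)) x) →
    (∃ x ∈ Set.Ioo (-1 : ℝ) 1, u x ≠ 0) →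
    ∀ x₁ ∈ Set.Ioo (-1 : ℝ) 1, ∀ x₂ ∈ Set.Ioo (-1 : ℝ) 1, u x₁ = 0 → u x₂ = 0 → x₁ = x₂

section LinearODE

open MeasureTheory intervalIntegral
open scoped Topology Nat

variable {E : Type*} [NormedAddCommGroup E] [NormedSpace ℝ E]

/-- The terms of the Peano–Baker series for `y' = A y`, `y t₀ = y₀`. -/
noncomputable def peanoBakerTerm (A : ℝ → E →L[ℝ] E) (t₀ : ℝ) (y₀ : E) : ℕ → ℝ → E
  | 0 => fun _ => y₀
  | n + 1 => fun t => ∫ s in t₀..t, A s (peanoBakerTerm A t₀ y₀ n s)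

variable {A : ℝ → E →L[ℝ] E} {a b t₀ : ℝ} {y₀ : E}

theorem hasDerivAt_integral_of_continuousOn_Ioo [CompleteSpace E] {f : ℝ → E}
    (hf : ContinuousOn f (Ioo a b)) (ht₀ : t₀ ∈ Ioo a b) {t : ℝ} (ht : t ∈ Ioo a b) :
    HasDerivAt (fun x => ∫ s in t₀..x, f s) (f t) t := by
  have hsub : uIcc t₀ t ⊆ Ioo a b := ordConnected_Ioo.uIcc_subset ht₀ ht
  exact integral_hasDerivAt_right (hf.mono hsub).intervalIntegrable
    (hf.stronglyMeasurableAtFilter isOpen_Ioo t ht) (hf.continuousAt (isOpen_Ioo.mem_nhds ht))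

theorem continuousOn_peanoBakerTerm [CompleteSpace E] (hA : ContinuousOn A (Ioo a b))
    (ht₀ : t₀ ∈ Ioo a b) (n : ℕ) : ContinuousOn (peanoBakerTerm A t₀ y₀ n) (Ioo a b) := by
  induction n with
  | zero => exact continuousOn_const
  | succ n ih =>
    exact fun t ht => (hasDerivAt_integral_of_continuousOn_Ioo (hA.clm_apply ih) ht₀
      ht).continuousAt.continuousWithinAt

theorem hasDerivAt_peanoBakerTerm_succ [CompleteSpace E] (hA : ContinuousOn A (Ioo a b))
    (ht₀ : t₀ ∈ Ioo a b) (n : ℕ) {t : ℝ} (ht : t ∈ Ioo a b) :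
    HasDerivAt (peanoBakerTerm A t₀ y₀ (n + 1)) (A t (peanoBakerTerm A t₀ y₀ n t)) t :=
  hasDerivAt_integral_of_continuousOn_Ioo
    (hA.clm_apply (continuousOn_peanoBakerTerm hA ht₀ n)) ht₀ ht

theorem norm_peanoBakerTerm_le {c d K : ℝ} (hK : ∀ t ∈ Icc c d, ‖A t‖ ≤ K)
    (ht₀ : t₀ ∈ Icc c d) (n : ℕ) {t : ℝ} (ht : t ∈ Icc c d) :
    ‖peanoBakerTerm A t₀ y₀ n t‖ ≤ (K * |t - t₀|) ^ n / n ! * ‖y₀‖ := by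
  have hK₀ : 0 ≤ K := (norm_nonneg _).trans (hK _ ht₀)
  induction n generalizing t with
  | zero => simp [peanoBakerTerm]
  | succ n ih =>
    calc
      _ ≤ |∫ s in t₀..t, K ^ (n + 1) * |s - t₀| ^ n / n ! * ‖y₀‖| := by
        refine norm_integral_le_abs_of_norm_le ?_ (Continuous.intervalIntegrable (by fun_prop) _ _)
        refine (ae_restrict_mem measurableSet_uIoc).mono fun s hs => ?_
        have hs : s ∈ Icc c d :=
          (uIoc_subset_uIcc.trans (uIcc_subset_Icc ht₀ ht)) hs
        calc
          _ ≤ ‖A s‖ * ‖peanoBakerTerm A t₀ y₀ n s‖ := (A s).le_opNorm _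
          _ ≤ K * ((K * |s - t₀|) ^ n / n ! * ‖y₀‖) := by gcongr; exacts [hK s hs, ih hs]
          _ = _ := by ring
      _ = _ := by
        rw [intervalIntegral.integral_mul_const, intervalIntegral.integral_div,
          intervalIntegral.integral_const_mul, abs_mul, abs_div, abs_mul,
          intervalIntegral.abs_intervalIntegral_eq, integral_pow_abs_sub_uIoc, Nat.factorial_succ,
          abs_div, abs_norm, abs_of_nonneg (pow_nonneg hK₀ _), Nat.abs_cast,
          abs_of_nonneg (pow_nonneg (abs_nonneg _) _),
          abs_of_nonneg (by positivity : (0 : ℝ) ≤ n + 1)]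
        push_cast
        field_simp
        ring

/-- A linear differential equation with coefficients continuous on an open interval has a solution
on the whole interval with any prescribed initial value. -/
theorem exists_hasDerivAt_linear_of_continuousOn_Ioo [CompleteSpace E]
    (hA : ContinuousOn A (Ioo a b)) (ht₀ : t₀ ∈ Ioo a b) (y₀ : E) :
    ∃ y : ℝ → E, y t₀ = y₀ ∧ ∀ t ∈ Ioo a b, HasDerivAt y (A t (y t)) t := by
  set v := peanoBakerTerm A t₀ y₀ with hv
  have hv₀ : ∀ n, v (n + 1) t₀ = 0 := fun n => by simp [hv, peanoBakerTerm]
  refine ⟨fun t => y₀ + ∑' n, v (n + 1) t, by simp [hv₀], fun t ht => ?_⟩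
  obtain ⟨c, hac, hc⟩ := exists_between (lt_min ht₀.1 ht.1)
  obtain ⟨d, hd, hdb⟩ := exists_between (max_lt ht₀.2 ht.2)
  rw [lt_min_iff] at hc
  rw [max_lt_iff] at hd
  have hsub : Icc c d ⊆ Ioo a b := Icc_subset_Ioo hac hdb
  obtain ⟨K, hK⟩ := isCompact_Icc.exists_bound_of_continuousOn (hA.mono hsub)
  have ht₀' : t₀ ∈ Ioo c d := ⟨hc.1, hd.1⟩
  have ht' : t ∈ Ioo c d := ⟨hc.2, hd.2⟩
  have hK₀ : 0 ≤ K := (norm_nonneg _).trans (hK _ (Ioo_subset_Icc_self ht'))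
  have hvb : ∀ n, ∀ s ∈ Ioo c d, ‖v n s‖ ≤ (K * (d - c)) ^ n / n ! * ‖y₀‖ := fun n s hs => by
    refine (norm_peanoBakerTerm_le hK (Ioo_subset_Icc_self ht₀') n
      (Ioo_subset_Icc_self hs)).trans ?_
    gcongr
    rw [abs_le]
    constructor <;> linarith [hs.1, hs.2, ht₀'.1, ht₀'.2]
  have hsum : Summable fun n : ℕ => (K * (d - c)) ^ n / n ! * ‖y₀‖ :=
    (Real.summable_pow_div_factorial _).mul_right _
  have hvsum : Summable fun n => v n t := .of_norm_bounded hsum fun n => hvb n t ht'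
  have hderiv : HasDerivAt (fun z => ∑' n, v (n + 1) z) (∑' n, A t (v n t)) t := by
    refine hasDerivAt_tsum_of_isPreconnected (g' := fun n s => A s (v n s)) (hsum.mul_left K)
      isOpen_Ioo isPreconnected_Ioo
      (fun n s hs => hasDerivAt_peanoBakerTerm_succ hA ht₀ n (hsub (Ioo_subset_Icc_self hs)))
      (fun n s hs => ?_) ht₀' (by simp [hv₀]) ht'
    refine ((A s).le_opNorm _).trans ?_
    gcongr
    exacts [hK s (Ioo_subset_Icc_self hs), hvb n s hs]
  convert hderiv.const_add y₀ using 1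
  rw [← (A t).map_tsum hvsum, hvsum.tsum_eq_zero_add]
  rfl

end LinearODE

section Nehari

theorem exists_solution_of_continuousOn_Ioo {p : ℝ → ℝ} {a b t₀ : ℝ}
    (hp : ContinuousOn p (Ioo a b)) (ht₀ : t₀ ∈ Ioo a b) (α β : ℝ) :
    ∃ u u' : ℝ → ℝ, u t₀ = α ∧ u' t₀ = β ∧ (∀ x ∈ Ioo a b, HasDerivAt u (u' x) x) ∧
      ∀ x ∈ Ioo a b, HasDerivAt u' (-(p x * u x)) x := by
  let A : ℝ → ℝ × ℝ →L[ℝ] ℝ × ℝ := fun x =>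
    (ContinuousLinearMap.inl ℝ ℝ ℝ).comp (ContinuousLinearMap.snd ℝ ℝ ℝ) -
      p x • (ContinuousLinearMap.inr ℝ ℝ ℝ).comp (ContinuousLinearMap.fst ℝ ℝ ℝ)
  have hA : ContinuousOn A (Ioo a b) := continuousOn_const.sub (hp.smul continuousOn_const)
  obtain ⟨y, hy₀, hy⟩ := exists_hasDerivAt_linear_of_continuousOn_Ioo hA ht₀ (α, β)
  refine ⟨fun x => (y x).1, fun x => (y x).2, by simp [hy₀], by simp [hy₀], fun x hx => ?_,
    fun x hx => ?_⟩
  · exact (hasFDerivAt_fst.comp_hasDerivAt x (hy x hx)).congr_deriv (by simp [A])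
  · exact (hasFDerivAt_snd.comp_hasDerivAt x (hy x hx)).congr_deriv (by simp [A])

theorem hasDerivAt_artanh {x : ℝ} (hx : x ∈ Ioo (-1 : ℝ) 1) :
    HasDerivAt Real.artanh (1 / (1 - x ^ 2)) x := by
  have h₁ : 0 < 1 + x := by linarith [hx.1]
  have h₂ : 0 < 1 - x := by linarith [hx.2]
  have h : HasDerivAt (fun y : ℝ => 1 / 2 * Real.log ((1 + y) / (1 - y))) (1 / (1 - x ^ 2)) x := by
    refine ((((hasDerivAt_id' x).const_add 1).fun_div ((hasDerivAt_id' x).const_sub 1)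
      h₂.ne').log (div_pos h₁ h₂).ne' |>.const_mul (1 / 2)).congr_deriv ?_
    have h₃ : 1 - x ^ 2 = (1 + x) * (1 - x) := by ring
    rw [h₃]
    field_simp
    ring
  refine h.congr_of_eventuallyEq ?_
  filter_upwards [isOpen_Ioo.mem_nhds hx] with y hy
  exact Real.artanh_eq_half_log (Ioo_subset_Icc_self hy)

/-- Sturm comparison with `φ'' + (1 + k²) / (1 - x²)² * φ = 0`, whose solution
`√(1 - x²) * cos (k * artanh x)` vanishes at `tanh (π / (2 * k))`. -/
theorem exists_zero_of_le_mul {p u u' : ℝ → ℝ} {k : ℝ} (hk : 0 < k)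
    (hp : ∀ x ∈ Ico (0 : ℝ) 1, 1 + k ^ 2 ≤ (1 - x ^ 2) ^ 2 * p x)
    (hu : ∀ x ∈ Ico (0 : ℝ) 1, HasDerivAt u (u' x) x)
    (hu' : ∀ x ∈ Ico (0 : ℝ) 1, HasDerivAt u' (-(p x * u x)) x)
    (hu₀ : u 0 = 1) (hu'₀ : u' 0 = 0) : ∃ x ∈ Ioo (0 : ℝ) 1, u x = 0 := by
  by_contra! hne
  have hcont : ContinuousOn u (Ico 0 1) := fun x hx => (hu x hx).continuousAt.continuousWithinAt
  have hpos : ∀ x ∈ Ico (0 : ℝ) 1, 0 < u x := by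
    intro x hx
    by_contra! hle
    obtain ⟨z, hz, hz0⟩ := intermediate_value_Icc' hx.1
      (hcont.mono (Icc_subset_Ico_right hx.2)) ⟨hle, by simp [hu₀]⟩
    rcases hz.1.eq_or_lt with rfl | h
    · simp [hu₀] at hz0
    · exact hne z ⟨h, hz.2.trans_lt hx.2⟩ hz0
  set x₀ := Real.tanh (Real.pi / (2 * k)) with hx₀
  have hart : Real.artanh x₀ = Real.pi / (2 * k) := Real.artanh_tanh _
  have hx₀1 : x₀ < 1 := Real.tanh_lt_one _
  have hx₀0 : 0 < x₀ := by
    rw [hx₀, Real.tanh_eq_sinh_div_cosh]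
    exact div_pos (Real.sinh_pos_iff.2 (by positivity)) (Real.cosh_pos _)
  set W : ℝ → ℝ := fun x => (u' x * (1 - x ^ 2) * Real.cos (k * Real.artanh x) +
    u x * (x * Real.cos (k * Real.artanh x) + k * Real.sin (k * Real.artanh x))) /
      √(1 - x ^ 2) with hW
  have hWd : ∀ x ∈ Ico (0 : ℝ) 1, HasDerivAt W (u x * Real.cos (k * Real.artanh x) *
      (1 + k ^ 2 - (1 - x ^ 2) ^ 2 * p x) / ((1 - x ^ 2) * √(1 - x ^ 2))) x := by
    intro x hx
    have hd : 0 < 1 - x ^ 2 := by nlinarith [hx.1, hx.2]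
    have hs : 0 < √(1 - x ^ 2) := Real.sqrt_pos.2 hd
    have hq : HasDerivAt (fun y : ℝ => 1 - y ^ 2) (-(2 * x)) x := by
      simpa using ((hasDerivAt_id x).pow 2).const_sub 1
    have hθ := (hasDerivAt_artanh (x := x) ⟨by linarith [hx.1], hx.2⟩).const_mul k
    have := (((((hu' x hx).mul hq).mul hθ.cos).add ((hu x hx).mul
      (((hasDerivAt_id x).mul hθ.cos).add (hθ.sin.const_mul k)))).div
        (hq.sqrt hd.ne') hs.ne')
    refine this.congr_deriv ?_
    simp only [Pi.add_apply, Pi.mul_apply, id]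
    have hsq := Real.sq_sqrt hd.le
    set s := √(1 - x ^ 2)
    rw [← hsq]
    have hx2 : x ^ 2 = 1 - s ^ 2 := by linarith
    field_simp
    ring_nf
    simp only [hx2]
    ring_nf
  have hanti : AntitoneOn W (Icc 0 x₀) := by
    have hmem : ∀ x ∈ Icc 0 x₀, x ∈ Ico (0 : ℝ) 1 := fun x hx => ⟨hx.1, hx.2.trans_lt hx₀1⟩
    refine antitoneOn_of_hasDerivWithinAt_nonpos (convex_Icc _ _)
      (fun x hx => (hWd x (hmem x hx)).continuousAt.continuousWithinAt)
      (fun x hx => (hWd x (hmem x (interior_subset hx))).hasDerivWithinAt) fun x hx => ?_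
    replace hx := interior_subset hx
    have hx1 := hmem x hx
    have hd : 0 < 1 - x ^ 2 := by nlinarith [hx1.1, hx1.2]
    have hθ₀ : 0 ≤ k * Real.artanh x := mul_nonneg hk.le (Real.artanh_nonneg hx.1)
    have hθ₁ : k * Real.artanh x ≤ Real.pi / 2 := by
      calc k * Real.artanh x ≤ k * (Real.pi / (2 * k)) := by
            rw [← hart]
            gcongr
            exact Real.artanh_le_artanh (by linarith [hx.1]) hx₀1 hx.2
        _ = Real.pi / 2 := by field_simp
    have hcos := Real.cos_nonneg_of_mem_Icc (x := k * Real.artanh x)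
      ⟨by linarith [Real.pi_pos], hθ₁⟩
    refine div_nonpos_of_nonpos_of_nonneg (mul_nonpos_of_nonneg_of_nonpos
      (mul_nonneg (hpos x hx1).le hcos) (by linarith [hp x hx1])) (by positivity)
  have hle := hanti (left_mem_Icc.2 hx₀0.le) (right_mem_Icc.2 hx₀0.le) hx₀0.le
  have hW₀ : W 0 = 0 := by simp [hW, hu'₀]
  have hWx₀ : W x₀ = u x₀ * k / √(1 - x₀ ^ 2) := by
    have : k * (Real.pi / (2 * k)) = Real.pi / 2 := by field_simp
    simp [hW, hart, this]
  have hd : 0 < 1 - x₀ ^ 2 := by nlinarith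
  have := hpos x₀ ⟨hx₀0.le, hx₀1⟩
  have : 0 < W x₀ := by rw [hWx₀]; positivity
  linarith

theorem IsNehariFunction.exists_lt {p : ℝ → ℝ} (hp : IsNehariFunction p) {m : ℝ} (hm : 1 < m) :
    ∃ x ∈ Ico (0 : ℝ) 1, (1 - x ^ 2) ^ 2 * p x < m := by
  obtain ⟨hcont, -, heven, -, hdisc⟩ := hp
  by_contra! hge
  obtain ⟨u, u', hu₀, hu'₀, hu, hu'⟩ :=
    exists_solution_of_continuousOn_Ioo hcont (t₀ := 0) (by simp) 1 0
  have hk : 0 < √(m - 1) := Real.sqrt_pos.2 (by linarith)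
  have hk2 : 1 + √(m - 1) ^ 2 = m := by rw [Real.sq_sqrt (by linarith)]; ring
  have hIoo : ∀ {x : ℝ}, x ∈ Ico (0 : ℝ) 1 → x ∈ Ioo (-1 : ℝ) 1 :=
    fun hx => ⟨by linarith [hx.1], hx.2⟩
  have hneg : ∀ {x : ℝ}, x ∈ Ico (0 : ℝ) 1 → -x ∈ Ioo (-1 : ℝ) 1 :=
    fun hx => ⟨by linarith [hx.2], by linarith [hx.1]⟩
  obtain ⟨x, hx, hux⟩ := exists_zero_of_le_mul hk (by rwa [hk2])
    (fun x hx => hu x (hIoo hx)) (fun x hx => hu' x (hIoo hx)) hu₀ hu'₀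
  obtain ⟨y, hy, huy⟩ := exists_zero_of_le_mul (p := p) (u := fun x => u (-x))
    (u' := fun x => -u' (-x)) hk (by rwa [hk2])
    (fun x hx => ((hu (-x) (hneg hx)).comp x (hasDerivAt_neg x)).congr_deriv (by ring))
    (fun x hx =>
      ((hu' (-x) (hneg hx)).comp x (hasDerivAt_neg x)).neg.congr_deriv
        (by rw [heven x (hIoo hx)]; ring))
    (by simpa using hu₀) (by simpa using hu'₀)
  have := hdisc u u' hu hu' ⟨0, by simp, by simp [hu₀]⟩ x (hIoo (Ioo_subset_Ico_self hx)) (-y)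
    (hneg (Ioo_subset_Ico_self hy)) hux huy
  linarith [hx.1, hy.1]

end Nehari

/-- For any Nehari function `p`, the limit `μ = lim_{x→1⁻} (1−x²)²·p(x)` exists and
satisfies `0 ≤ μ ≤ 1`. -/
theorem stmt4 (p : ℝ → ℝ) (hp : IsNehariFunction p) :
    ∃ μ : ℝ, 0 ≤ μ ∧ μ ≤ 1 ∧
      Tendsto (fun x => (1 - x ^ 2) ^ 2 * p x) (nhdsWithin 1 (Ioo (-1 : ℝ) 1)) (nhds μ) := by
  have hlt := fun m (hm : 1 < m) => hp.exists_lt (m := m) hm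
  obtain ⟨-, hpos, -, hanti, -⟩ := hp
  set q : ℝ → ℝ := fun x => (1 - x ^ 2) ^ 2 * p x with hq
  have hq0 : ∀ x ∈ Ico (0 : ℝ) 1, 0 ≤ q x := fun x hx =>
    mul_nonneg (sq_nonneg _) (hpos x ⟨by linarith [hx.1], hx.2⟩).le
  have hne : (q '' Ico 0 1).Nonempty := ⟨q 0, 0, by simp, rfl⟩
  have hbdd : BddBelow (q '' Ico 0 1) := ⟨0, forall_mem_image.2 hq0⟩
  refine ⟨sInf (q '' Ico 0 1), le_csInf hne (forall_mem_image.2 hq0), ?_, ?_⟩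
  · refine le_of_forall_gt_imp_ge_of_dense fun m hm => ?_
    obtain ⟨x, hx, hxm⟩ := hlt m hm
    exact (csInf_le hbdd ⟨x, hx, rfl⟩).trans hxm.le
  · rw [nhdsWithin_Ioo_eq_nhdsLT (by norm_num), tendsto_order]
    refine ⟨fun l hl => ?_, fun m hm => ?_⟩
    · filter_upwards [Ico_mem_nhdsLT (zero_lt_one' ℝ)] with x hx
      exact hl.trans_le (csInf_le hbdd ⟨x, hx, rfl⟩)
    · obtain ⟨_, ⟨z, hz, rfl⟩, hzm⟩ := exists_lt_of_csInf_lt hne hm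
      filter_upwards [Ico_mem_nhdsLT hz.2] with x hx
      exact (hanti hz ⟨hz.1.trans hx.1, hx.2⟩ hx.1).trans_lt hzm
end

section
/- Let p be a Nehari function with μ = lim_{x→1⁻} (1−x²)²·p(x) = 1. Then p(x) = (1−x²)^{−2} for all x ∈ (−1,1). -/
open Set Filter

/-- Successive approximations to the solution of `u'' + P * u = 0`, `u 0 = 1`, `u' 0 = 0`:
the solution is the sum of these terms. -/
noncomputable def volterraTerm (P : ℝ → ℝ) : ℕ → ℝ → ℝ
  | 0 => fun _ => 1
  | n + 1 => fun x => ∫ t in (0 : ℝ)..x, -∫ s in (0 : ℝ)..t, P s * volterraTerm P n s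

/-- The derivative of `volterraTerm P (n + 1)`. -/
noncomputable def volterraSlope (P : ℝ → ℝ) (n : ℕ) (t : ℝ) : ℝ :=
  -∫ s in (0 : ℝ)..t, P s * volterraTerm P n s

theorem volterraTerm_succ (P : ℝ → ℝ) (n : ℕ) (x : ℝ) :
    volterraTerm P (n + 1) x = ∫ t in (0 : ℝ)..x, volterraSlope P n t := rfl

theorem volterraTerm_neg {P : ℝ → ℝ} (hP : ∀ x, P (-x) = P x) (n : ℕ) (x : ℝ) :
    volterraTerm P n (-x) = volterraTerm P n x := by
  induction n generalizing x with
  | zero => rfl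
  | succ n ih =>
    have hs : ∀ t, volterraSlope P n (-t) = -volterraSlope P n t := by
      intro t
      have h := intervalIntegral.integral_comp_neg (a := 0) (b := -t)
        (fun s => P s * volterraTerm P n s)
      simp only [hP, ih, neg_zero, neg_neg] at h
      rw [volterraSlope, volterraSlope, h, intervalIntegral.integral_symm]
    have h := intervalIntegral.integral_comp_neg (a := 0) (b := -x) (volterraSlope P n)
    simp only [hs, neg_zero, neg_neg, intervalIntegral.integral_neg] at h
    rw [intervalIntegral.integral_symm 0 x, neg_inj] at h
    rw [volterraTerm_succ, volterraTerm_succ, h]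

theorem uIcc_zero_subset_Ioo {x : ℝ} (hx : x ∈ Ioo (-1 : ℝ) 1) : uIcc 0 x ⊆ Ioo (-1 : ℝ) 1 :=
  ordConnected_Ioo.uIcc_subset (by simp) hx

theorem hasDerivAt_integral_of_continuousOn {f : ℝ → ℝ} (hf : ContinuousOn f (Ioo (-1 : ℝ) 1))
    {x : ℝ} (hx : x ∈ Ioo (-1 : ℝ) 1) :
    HasDerivAt (fun t => ∫ s in (0 : ℝ)..t, f s) (f x) x :=
  intervalIntegral.integral_hasDerivAt_right
    (hf.mono (uIcc_zero_subset_Ioo hx)).intervalIntegrable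
    (hf.stronglyMeasurableAtFilter isOpen_Ioo x hx)
    (hf.continuousAt (isOpen_Ioo.mem_nhds hx))

section Existence

variable {P : ℝ → ℝ}

theorem continuousOn_volterraTerm (hP : ContinuousOn P (Ioo (-1 : ℝ) 1)) (n : ℕ) :
    ContinuousOn (volterraTerm P n) (Ioo (-1 : ℝ) 1) := by
  induction n with
  | zero => exact continuousOn_const
  | succ n ih =>
    have hs : ContinuousOn (volterraSlope P n) (Ioo (-1 : ℝ) 1) := fun x hx =>
      (hasDerivAt_integral_of_continuousOn (hP.mul ih) hx).neg.continuousAt.continuousWithinAt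
    exact fun x hx =>
      (hasDerivAt_integral_of_continuousOn hs hx).continuousAt.continuousWithinAt

theorem hasDerivAt_volterraSlope (hP : ContinuousOn P (Ioo (-1 : ℝ) 1)) (n : ℕ) {x : ℝ}
    (hx : x ∈ Ioo (-1 : ℝ) 1) :
    HasDerivAt (volterraSlope P n) (-(P x * volterraTerm P n x)) x :=
  (hasDerivAt_integral_of_continuousOn (hP.mul (continuousOn_volterraTerm hP n)) hx).neg

theorem hasDerivAt_volterraTerm_succ (hP : ContinuousOn P (Ioo (-1 : ℝ) 1)) (n : ℕ) {x : ℝ}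
    (hx : x ∈ Ioo (-1 : ℝ) 1) :
    HasDerivAt (volterraTerm P (n + 1)) (volterraSlope P n x) x :=
  hasDerivAt_integral_of_continuousOn
    (fun _ hy => (hasDerivAt_volterraSlope hP n hy).continuousAt.continuousWithinAt) hx

theorem mem_Ioo_neg_of_mem_uIoc {a x s : ℝ} (hx : x ∈ Ioo (-a) a) (hs : s ∈ uIoc 0 x) :
    s ∈ Ioo (-a) a :=
  ordConnected_Ioo.uIcc_subset (by constructor <;> linarith [hx.1, hx.2]) hx
    (uIoc_subset_uIcc hs)

theorem abs_le_of_mem_uIoc_zero {x s : ℝ} (hs : s ∈ uIoc 0 x) : |s| ≤ |x| := by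
  have := abs_sub_left_of_mem_uIcc (uIoc_subset_uIcc hs)
  simpa using this

theorem abs_volterraSlope_le {a M : ℝ} (hM : ∀ x ∈ Ioo (-a) a, |P x| ≤ M) (n : ℕ)
    (hf : ∀ x ∈ Ioo (-a) a, |volterraTerm P n x| ≤ M ^ n * |x| ^ n / n.factorial)
    {x : ℝ} (hx : x ∈ Ioo (-a) a) :
    |volterraSlope P n x| ≤ M ^ (n + 1) * |x| ^ (n + 1) / (n + 1).factorial := by
  have hM0 : 0 ≤ M := (abs_nonneg _).trans (hM x hx)
  have hbound : ∀ s ∈ uIoc 0 x,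
      ‖P s * volterraTerm P n s‖ ≤ M ^ (n + 1) / n.factorial * |s - 0| ^ n := by
    intro s hs
    have hs' := mem_Ioo_neg_of_mem_uIoc hx hs
    rw [norm_mul, Real.norm_eq_abs, Real.norm_eq_abs, sub_zero]
    calc |P s| * |volterraTerm P n s| ≤ M * (M ^ n * |s| ^ n / n.factorial) :=
          mul_le_mul (hM s hs') (hf s hs') (abs_nonneg _) hM0
      _ = _ := by ring
  have hint : IntervalIntegrable (fun s : ℝ => M ^ (n + 1) / n.factorial * |s - 0| ^ n)
      MeasureTheory.volume 0 x := by
    apply Continuous.intervalIntegrable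
    fun_prop
  rw [volterraSlope, abs_neg, ← Real.norm_eq_abs, intervalIntegral.norm_intervalIntegral_eq]
  refine (MeasureTheory.norm_integral_le_of_norm_le
    (intervalIntegrable_iff.mp hint)
    ((MeasureTheory.ae_restrict_iff' measurableSet_uIoc).mpr (.of_forall hbound))).trans
    (le_of_eq ?_)
  rw [MeasureTheory.integral_const_mul, integral_pow_abs_sub_uIoc, sub_zero, Nat.factorial_succ]
  push_cast
  field_simp

theorem abs_volterraTerm_le {a M : ℝ} (ha : a ≤ 1) (hM : ∀ x ∈ Ioo (-a) a, |P x| ≤ M) (n : ℕ) :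
    ∀ x ∈ Ioo (-a) a, |volterraTerm P n x| ≤ M ^ n * |x| ^ n / n.factorial := by
  induction n with
  | zero => intro x _; simp [volterraTerm]
  | succ n ih =>
    intro x hx
    have hM0 : 0 ≤ M := (abs_nonneg _).trans (hM x hx)
    have hx1 : |x| ≤ 1 := abs_le.mpr ⟨by linarith [hx.1], by linarith [hx.2]⟩
    have h := intervalIntegral.norm_integral_le_of_norm_le_const (a := 0) (b := x)
      (f := volterraSlope P n) (C := M ^ (n + 1) * |x| ^ (n + 1) / (n + 1).factorial) (by
        intro s hs
        refine (abs_volterraSlope_le hM n ih (mem_Ioo_neg_of_mem_uIoc hx hs)).trans ?_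
        gcongr ?_ * ?_ ^ _ / _
        exact abs_le_of_mem_uIoc_zero hs)
    rw [sub_zero] at h
    exact h.trans (mul_le_of_le_one_right (by positivity) hx1)

theorem exists_even_solution (hP : ContinuousOn P (Ioo (-1 : ℝ) 1)) (heven : ∀ x, P (-x) = P x) :
    ∃ u u' : ℝ → ℝ, (∀ x ∈ Ioo (-1 : ℝ) 1, HasDerivAt u (u' x) x) ∧
      (∀ x ∈ Ioo (-1 : ℝ) 1, HasDerivAt u' (-(P x * u x)) x) ∧
      u 0 = 1 ∧ u' 0 = 0 ∧ ∀ x, u (-x) = u x := by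
  have hlocal : ∀ x ∈ Ioo (-1 : ℝ) 1, ∃ a M : ℝ, 0 < a ∧ a < 1 ∧ x ∈ Ioo (-a) a ∧
      0 ≤ M ∧ ∀ y ∈ Ioo (-a) a, |P y| ≤ M := by
    intro x hx
    have hx1 : |x| < 1 := abs_lt.mpr hx
    have hx0 := abs_nonneg x
    obtain ⟨M, hM⟩ := (isCompact_Icc (a := -((1 + |x|) / 2))
      (b := (1 + |x|) / 2)).exists_bound_of_continuousOn
      (hP.mono fun y hy => ⟨by linarith [hy.1], by linarith [hy.2]⟩)
    have hxa : x ∈ Ioo (-((1 + |x|) / 2)) ((1 + |x|) / 2) := abs_lt.mp (by linarith)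
    refine ⟨(1 + |x|) / 2, M, by linarith, by linarith, hxa, ?_,
      fun y hy => hM y (Ioo_subset_Icc_self hy)⟩
    exact (norm_nonneg _).trans (hM x (Ioo_subset_Icc_self hxa))
  have hsum : ∀ M : ℝ, Summable fun n : ℕ => M ^ n / n.factorial := Real.summable_pow_div_factorial
  have hle : ∀ {a M : ℝ}, a < 1 → 0 ≤ M → ∀ n : ℕ, ∀ y ∈ Ioo (-a) a,
      M ^ n * |y| ^ n / n.factorial ≤ M ^ n / n.factorial := by
    intro a M ha hM0 n y hy
    have : |y| ^ n ≤ 1 := pow_le_one₀ (abs_nonneg y)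
      (abs_le.mpr ⟨by linarith [hy.1], by linarith [hy.2]⟩)
    gcongr
    exact mul_le_of_le_one_right (by positivity) this
  have hzero : ∀ n, volterraTerm P (n + 1) 0 = 0 := fun n => by simp [volterraTerm_succ]
  have hslope : ∀ n, volterraSlope P n 0 = 0 := fun n => by simp [volterraSlope]
  refine ⟨fun x => 1 + ∑' n, volterraTerm P (n + 1) x, fun x => ∑' n, volterraSlope P n x,
    ?_, ?_, by simp [hzero], by simp [hslope], fun x => by simp [volterraTerm_neg heven]⟩
  · intro x hx
    obtain ⟨a, M, ha0, ha, hxa, hM0, hM⟩ := hlocal x hx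
    refine (hasDerivAt_tsum_of_isPreconnected (t := Ioo (-a) a) (y₀ := 0)
      ((summable_nat_add_iff 1).mpr (hsum M)) isOpen_Ioo isPreconnected_Ioo
      (fun n y hy => hasDerivAt_volterraTerm_succ hP n ⟨by linarith [hy.1], by linarith [hy.2]⟩)
      (fun n y hy => ?_) (by simp [ha0]) (by simp [hzero, summable_zero]) hxa).const_add 1
    exact (abs_volterraSlope_le hM n (abs_volterraTerm_le ha.le hM n) hy).trans
      (hle ha hM0 (n + 1) y hy)
  · intro x hx
    obtain ⟨a, M, ha0, ha, hxa, hM0, hM⟩ := hlocal x hx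
    have hterm : ∀ n, ∀ y ∈ Ioo (-a) a, |volterraTerm P n y| ≤ M ^ n / n.factorial := fun n y hy =>
      (abs_volterraTerm_le ha.le hM n y hy).trans (hle ha hM0 n y hy)
    have hsummable : Summable fun n => volterraTerm P n x :=
      Summable.of_norm_bounded (hsum M) fun n => hterm n x hxa
    have h := hasDerivAt_tsum_of_isPreconnected (t := Ioo (-a) a) (y₀ := 0)
      ((hsum M).mul_left M) isOpen_Ioo isPreconnected_Ioo
      (fun n y hy => hasDerivAt_volterraSlope hP n ⟨by linarith [hy.1], by linarith [hy.2]⟩)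
      (fun n y hy => by
        rw [norm_neg, norm_mul]
        exact mul_le_mul (hM y hy) (hterm n y hy) (abs_nonneg _) hM0)
      (by simp [ha0]) (by simp [hslope, summable_zero]) hxa
    rw [tsum_neg, tsum_mul_left, hsummable.tsum_eq_zero_add] at h
    exact h

end Existence

theorem hasDerivAt_sqrt_one_sub_sq {x : ℝ} (hx : x ∈ Ioo (-1 : ℝ) 1) :
    HasDerivAt (fun y : ℝ => √(1 - y ^ 2)) (-x / √(1 - x ^ 2)) x := by
  have h1 : 0 < 1 - x ^ 2 := by nlinarith [hx.1, hx.2]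
  convert ((hasDerivAt_pow 2 x).const_sub 1).sqrt h1.ne' using 1
  have := Real.sqrt_pos.mpr h1
  field_simp
  simp [mul_comm]

theorem hasDerivAt_neg_div_sqrt_one_sub_sq {x : ℝ} (hx : x ∈ Ioo (-1 : ℝ) 1) :
    HasDerivAt (fun y : ℝ => -y / √(1 - y ^ 2))
      (-(((1 - x ^ 2) ^ 2)⁻¹ * √(1 - x ^ 2))) x := by
  have h1 : 0 < 1 - x ^ 2 := by nlinarith [hx.1, hx.2]
  have hr := Real.sqrt_pos.mpr h1
  have hsq := Real.sq_sqrt h1.le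
  refine ((hasDerivAt_neg x).div (hasDerivAt_sqrt_one_sub_sq hx) hr.ne').congr_deriv ?_
  have hx2 : x ^ 2 = 1 - √(1 - x ^ 2) ^ 2 := by linarith
  set r := √(1 - x ^ 2)
  rw [← hsq]
  field_simp
  linarith

/-- A positive solution on `[0, 1)` with `u' 0 = 0` forces a coefficient which dominates
`(1 - x²)⁻²` to coincide with it. -/
theorem eq_inv_of_positive_solution {p u u' : ℝ → ℝ}
    (hge : ∀ x ∈ Ico (0 : ℝ) 1, ((1 - x ^ 2) ^ 2)⁻¹ ≤ p x)
    (hu : ∀ x ∈ Ioo (-1 : ℝ) 1, HasDerivAt u (u' x) x)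
    (hu' : ∀ x ∈ Ioo (-1 : ℝ) 1, HasDerivAt u' (-(p x * u x)) x)
    (hu0 : u' 0 = 0) (hpos : ∀ x ∈ Ico (0 : ℝ) 1, 0 < u x) :
    ∀ x ∈ Ico (0 : ℝ) 1, p x = ((1 - x ^ 2) ^ 2)⁻¹ := by
  have hsub : Ico (0 : ℝ) 1 ⊆ Ioo (-1) 1 := fun x hx => ⟨by linarith [hx.1], hx.2⟩
  have hsqrt : ∀ x ∈ Ico (0 : ℝ) 1, 0 < √(1 - x ^ 2) := fun x hx =>
    Real.sqrt_pos.mpr (by nlinarith [hx.1, hx.2])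
  set W : ℝ → ℝ := fun x => u' x * √(1 - x ^ 2) - u x * (-x / √(1 - x ^ 2)) with hW
  have hWderiv : ∀ x ∈ Ico (0 : ℝ) 1,
      HasDerivAt W (-((p x - ((1 - x ^ 2) ^ 2)⁻¹) * (u x * √(1 - x ^ 2)))) x := by
    intro x hx
    refine (((hu' x (hsub hx)).mul (hasDerivAt_sqrt_one_sub_sq (hsub hx))).sub
      ((hu x (hsub hx)).mul (hasDerivAt_neg_div_sqrt_one_sub_sq (hsub hx)))).congr_deriv ?_
    ring
  have hW0 : W 0 = 0 := by simp [hW, hu0]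
  have hWanti : AntitoneOn W (Ico 0 1) := by
    refine antitoneOn_of_hasDerivWithinAt_nonpos (convex_Ico 0 1)
      (fun x hx => (hWderiv x hx).continuousAt.continuousWithinAt)
      (fun x hx => (hWderiv x (interior_subset hx)).hasDerivWithinAt) (fun x hx => ?_)
    have hx := interior_subset hx
    exact neg_nonpos.mpr (mul_nonneg (sub_nonneg.mpr (hge x hx))
      (mul_pos (hpos x hx) (hsqrt x hx)).le)
  have hWnonneg : ∀ x ∈ Ico (0 : ℝ) 1, 0 ≤ W x := by
    by_contra! ⟨a, ha, hneg⟩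
    set c := -W a with hc
    have hc0 : 0 < c := by linarith
    set φ : ℝ → ℝ := fun x => u x / √(1 - x ^ 2) - c / 2 * Real.log (1 - x) with hφ
    have hsub' : Ico a 1 ⊆ Ico 0 1 := Ico_subset_Ico_left ha.1
    have hφderiv : ∀ x ∈ Ico a 1,
        HasDerivAt φ (W x / (1 - x ^ 2) + c / 2 / (1 - x)) x := by
      intro x hx
      have hx0 := hsub' hx
      have hr := hsqrt x hx0
      have h1x : 0 < 1 - x := by linarith [hx.2]
      have hsq : √(1 - x ^ 2) ^ 2 = 1 - x ^ 2 := Real.sq_sqrt (by nlinarith [hx0.1, hx.2])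
      refine (((hu x (hsub hx0)).div (hasDerivAt_sqrt_one_sub_sq (hsub hx0)) hr.ne').sub
        ((((hasDerivAt_id x).const_sub 1).log h1x.ne').const_mul (c / 2))).congr_deriv ?_
      simp only [hW, hsq, id]
      ring
    have hφanti : AntitoneOn φ (Ico a 1) := by
      refine antitoneOn_of_hasDerivWithinAt_nonpos (convex_Ico a 1)
        (fun x hx => (hφderiv x hx).continuousAt.continuousWithinAt)
        (fun x hx => (hφderiv x (interior_subset hx)).hasDerivWithinAt) (fun x hx => ?_)
      have hx := interior_subset hx
      have hx0 := hsub' hx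
      have hWx : W x ≤ -c := by
        rw [hc, neg_neg]
        exact hWanti ha hx0 hx.1
      have h1x : 0 < 1 - x := by linarith [hx.2]
      have h2x : 0 < 1 + x := by linarith [hx0.1]
      have heq : W x / (1 - x ^ 2) + c / 2 / (1 - x)
          = (W x + c * (1 + x) / 2) / ((1 - x) * (1 + x)) := by
        rw [show 1 - x ^ 2 = (1 - x) * (1 + x) by ring]
        field_simp
      rw [heq]
      refine div_nonpos_of_nonpos_of_nonneg ?_ (mul_pos h1x h2x).le
      nlinarith [hx.2]
    set K := 2 * (φ a + 1) / c with hK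
    have hxa : max a (1 - Real.exp (-K)) ∈ Ico a 1 :=
      ⟨le_max_left _ _, max_lt ha.2 (by linarith [Real.exp_pos (-K)])⟩
    set x := max a (1 - Real.exp (-K)) with hx
    have hlog : Real.log (1 - x) ≤ -K := by
      rw [Real.log_le_iff_le_exp (by linarith [hxa.2])]
      linarith [le_max_right a (1 - Real.exp (-K))]
    have hle : φ x ≤ φ a := hφanti (left_mem_Ico.mpr ha.2) hxa hxa.1
    have hdiv : 0 < u x / √(1 - x ^ 2) := div_pos (hpos x (hsub' hxa)) (hsqrt x (hsub' hxa))
    have hmul : c / 2 * Real.log (1 - x) ≤ c / 2 * -K := by gcongr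
    have hcK : c / 2 * -K = -(φ a + 1) := by
      rw [hK]
      field_simp
    have hφx : φ x = u x / √(1 - x ^ 2) - c / 2 * Real.log (1 - x) := rfl
    linarith
  intro x hx
  have hWzero : ∀ y ∈ Ico (0 : ℝ) 1, W y = 0 := fun y hy =>
    le_antisymm (hW0 ▸ hWanti (by simp) hy hy.1) (hWnonneg y hy)
  have hd : HasDerivWithinAt W 0 (Ico 0 1) x :=
    (hasDerivWithinAt_const x (Ico (0 : ℝ) 1) (0 : ℝ)).congr hWzero (hWzero x hx)
  have h := (uniqueDiffOn_Ico (0 : ℝ) 1 x hx).eq_deriv _ (hWderiv x hx).hasDerivWithinAt hd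
  have hne := (mul_pos (hpos x hx) (hsqrt x hx)).ne'
  simpa [sub_eq_zero, (hpos x hx).ne', (hsqrt x hx).ne'] using h

/-- If `p` is a Nehari function with `μ = lim_{x→1⁻} (1−x²)²·p(x) = 1`,
then `p(x) = (1−x²)⁻²` on `(−1,1)`. -/
theorem stmt5 (p : ℝ → ℝ) (hp : IsNehariFunction p)
    (hμ : Tendsto (fun x => (1 - x ^ 2) ^ 2 * p x) (nhdsWithin 1 (Ioo (-1 : ℝ) 1)) (nhds 1)) :
    ∀ x ∈ Ioo (-1 : ℝ) 1, p x = ((1 - x ^ 2) ^ 2)⁻¹ := by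
  obtain ⟨hcont, -, heven, hanti, hzeros⟩ := hp
  have hsub : Ico (0 : ℝ) 1 ⊆ Ioo (-1) 1 := fun x hx => ⟨by linarith [hx.1], hx.2⟩
  have hge : ∀ x ∈ Ico (0 : ℝ) 1, ((1 - x ^ 2) ^ 2)⁻¹ ≤ p x := by
    intro x hx
    have : (nhdsWithin (1 : ℝ) (Ioo (-1 : ℝ) 1)).NeBot := right_nhdsWithin_Ioo_neBot (by norm_num)
    have h1 : 1 ≤ (1 - x ^ 2) ^ 2 * p x := by
      refine le_of_tendsto hμ ?_
      filter_upwards [self_mem_nhdsWithin, nhdsWithin_le_nhds (lt_mem_nhds hx.2)] with y hy hxy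
      exact hanti hx ⟨hx.1.trans hxy.le, hy.2⟩ hxy.le
    have h2 : 0 < (1 - x ^ 2) ^ 2 := pow_pos (by nlinarith [hx.1, hx.2]) 2
    exact (inv_le_iff_one_le_mul₀' h2).mpr h1
  set P : ℝ → ℝ := (Ioo (-1 : ℝ) 1).indicator p with hPdef
  have hPp : ∀ x ∈ Ioo (-1 : ℝ) 1, P x = p x := fun x hx => indicator_of_mem hx p
  have hPeven : ∀ x, P (-x) = P x := by
    intro x
    by_cases hx : x ∈ Ioo (-1 : ℝ) 1
    · have hx' : -x ∈ Ioo (-1 : ℝ) 1 := ⟨by linarith [hx.2], by linarith [hx.1]⟩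
      rw [hPp x hx, hPp _ hx', heven x hx]
    · have hx' : -x ∉ Ioo (-1 : ℝ) 1 := fun h => hx ⟨by linarith [h.2], by linarith [h.1]⟩
      rw [hPdef, indicator_of_notMem hx, indicator_of_notMem hx']
  obtain ⟨u, u', hu, hu', hu0, hu'0, hueven⟩ := exists_even_solution (hcont.congr hPp) hPeven
  have hu'' : ∀ x ∈ Ioo (-1 : ℝ) 1, HasDerivAt u' (-(p x * u x)) x := fun x hx =>
    hPp x hx ▸ hu' x hx
  have hne : ∀ x ∈ Ico (0 : ℝ) 1, u x ≠ 0 := by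
    intro x hx h
    have := hzeros u u' hu hu'' ⟨0, by simp, by simp [hu0]⟩ x (hsub hx) (-x)
      ⟨by linarith [hx.2], by linarith [hx.1]⟩ h (by rw [hueven, h])
    have hx0 : x = 0 := by linarith
    rw [hx0, hu0] at h
    exact one_ne_zero h
  have hpos : ∀ x ∈ Ico (0 : ℝ) 1, 0 < u x := by
    intro x hx
    by_contra! hle
    obtain ⟨y, hy, hy0⟩ := intermediate_value_Icc' hx.1
      (fun z hz => (hu z (hsub ⟨hz.1, hz.2.trans_lt hx.2⟩)).continuousAt.continuousWithinAt)
      ⟨hle, by simp [hu0]⟩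
    exact hne y ⟨hy.1, hy.2.trans_lt hx.2⟩ hy0
  have key := eq_inv_of_positive_solution hge hu hu'' hu'0 hpos
  intro x hx
  rcases le_total 0 x with h | h
  · exact key x ⟨h, hx.2⟩
  · have := key (-x) ⟨by linarith, by linarith [hx.1]⟩
    rwa [heven x hx, neg_sq] at this
end

section
/- For each parameter t with 1 < t < 2, the function p(x) = t(1−(t−1)x²)/(1−x²)² is a Nehari function with lim_{x→1⁻} (1−x²)²·p(x) = t(2−t). In particular, the function u(x) = (1−x²)^{t/2} is a solution of the differential equation u'' + p·u = 0 having no zeros on (−1,1). -/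
open Set Filter

/-- A function whose derivative vanishes on an open interval is constant there. -/
theorem eq_of_hasDerivAt_zero_Ioo {a b : ℝ} {f : ℝ → ℝ}
    (hf : ∀ x ∈ Ioo a b, HasDerivAt f 0 x) {x y : ℝ} (hx : x ∈ Ioo a b) (hy : y ∈ Ioo a b) :
    f x = f y :=
  isOpen_Ioo.is_const_of_deriv_eq_zero isPreconnected_Ioo
    (fun z hz => (hf z hz).differentiableAt.differentiableWithinAt)
    (fun z hz => (hf z hz).deriv) hx hy

/-- If `u'' + p·u = 0` has a zero-free solution `v` on an interval, then every nontrivial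
solution has at most one zero there. -/
theorem eq_of_zeros_of_nonvanishing_solution {a b : ℝ} {p u u' v v' : ℝ → ℝ}
    (hu : ∀ x ∈ Ioo a b, HasDerivAt u (u' x) x)
    (hu' : ∀ x ∈ Ioo a b, HasDerivAt u' (-(p x * u x)) x)
    (hv : ∀ x ∈ Ioo a b, HasDerivAt v (v' x) x)
    (hv' : ∀ x ∈ Ioo a b, HasDerivAt v' (-(p x * v x)) x)
    (hv0 : ∀ x ∈ Ioo a b, v x ≠ 0)
    (hne : ∃ x ∈ Ioo a b, u x ≠ 0)
    {x₁ x₂ : ℝ} (hx₁ : x₁ ∈ Ioo a b) (hx₂ : x₂ ∈ Ioo a b) (h₁ : u x₁ = 0) (h₂ : u x₂ = 0) :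
    x₁ = x₂ := by
  wlog hlt : x₁ < x₂ generalizing x₁ x₂
  · rcases lt_trichotomy x₁ x₂ with h | h | h
    · exact absurd h hlt
    · exact h
    · exact (this hx₂ hx₁ h₂ h₁ h).symm
  exfalso
  have hW : ∀ x ∈ Ioo a b, HasDerivAt (fun x => u' x * v x - u x * v' x) 0 x := fun x hx => by
    refine (((hu' x hx).fun_mul (hv x hx)).fun_sub
      ((hu x hx).fun_mul (hv' x hx))).congr_deriv ?_
    ring
  have hq : ∀ x ∈ Ioo a b,
      HasDerivAt (fun x => u x / v x) ((u' x * v x - u x * v' x) / v x ^ 2) x :=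
    fun x hx => (hu x hx).fun_div (hv x hx) (hv0 x hx)
  have hsub : Icc x₁ x₂ ⊆ Ioo a b := fun x hx =>
    ⟨hx₁.1.trans_le hx.1, hx.2.trans_lt hx₂.2⟩
  obtain ⟨c, hc, hc0⟩ := exists_hasDerivAt_eq_zero hlt
    (fun x hx => (hq x (hsub hx)).continuousAt.continuousWithinAt) (by simp [h₁, h₂])
    (fun x hx => hq x (hsub (Ioo_subset_Icc_self hx)))
  have hcI := hsub (Ioo_subset_Icc_self hc)
  have hWc : u' c * v c - u c * v' c = 0 := by
    simpa [hv0 c hcI] using hc0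
  obtain ⟨y, hy, huy⟩ := hne
  have hconst : u y / v y = u x₁ / v x₁ := eq_of_hasDerivAt_zero_Ioo (fun x hx => by
    have hWx : u' x * v x - u x * v' x = 0 := (eq_of_hasDerivAt_zero_Ioo hW hx hcI).trans hWc
    simpa [hWx] using hq x hx) hy hx₁
  rw [h₁, zero_div, div_eq_zero_iff] at hconst
  exact hconst.elim huy (hv0 y hy)

theorem one_sub_sq_pos_of_mem_Ioo {x : ℝ} (hx : x ∈ Ioo (-1 : ℝ) 1) : 0 < 1 - x ^ 2 := by
  nlinarith [hx.1, hx.2]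

theorem hasDerivAt_one_sub_sq_rpow (s : ℝ) {x : ℝ} (hx : x ∈ Ioo (-1 : ℝ) 1) :
    HasDerivAt (fun y : ℝ => (1 - y ^ 2) ^ s) (-2 * s * x * (1 - x ^ 2) ^ (s - 1)) x := by
  have h : HasDerivAt (fun y : ℝ => 1 - y ^ 2) (-(2 * x)) x := by
    simpa using (hasDerivAt_pow 2 x).const_sub 1
  refine (h.rpow_const (p := s) (Or.inl (one_sub_sq_pos_of_mem_Ioo hx).ne')).congr_deriv ?_
  ring

/-- For `1 < t < 2`, the function `p(x) = t(1−(t−1)x²)/(1−x²)²` is a Nehari function with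
`lim_{x→1⁻} (1−x²)²·p(x) = t(2−t)`; in particular `u(x) = (1−x²)^{t/2}`
(with `u'(x) = −t·x·(1−x²)^{t/2−1}`) solves `u'' + p·u = 0` and has no zeros on `(−1,1)`. -/
theorem stmt6 (t : ℝ) (ht1 : 1 < t) (ht2 : t < 2)
    (p : ℝ → ℝ) (hpdef : ∀ x : ℝ, p x = t * (1 - (t - 1) * x ^ 2) / (1 - x ^ 2) ^ 2) :
    IsNehariFunction p ∧
    Tendsto (fun x => (1 - x ^ 2) ^ 2 * p x) (nhdsWithin 1 (Ioo (-1 : ℝ) 1))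
      (nhds (t * (2 - t))) ∧
    (∀ x ∈ Ioo (-1 : ℝ) 1,
      HasDerivAt (fun s : ℝ => (1 - s ^ 2) ^ (t / 2))
        (-t * x * (1 - x ^ 2) ^ (t / 2 - 1)) x) ∧
    (∀ x ∈ Ioo (-1 : ℝ) 1,
      HasDerivAt (fun s : ℝ => -t * s * (1 - s ^ 2) ^ (t / 2 - 1))
        (-(p x * (1 - x ^ 2) ^ (t / 2))) x) ∧
    (∀ x ∈ Ioo (-1 : ℝ) 1, (1 - x ^ 2) ^ (t / 2) ≠ 0) := by
  have hw : ∀ x ∈ Ioo (-1 : ℝ) 1, 0 < 1 - x ^ 2 := fun x hx => one_sub_sq_pos_of_mem_Ioo hx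
  have hwp : ∀ x ∈ Ioo (-1 : ℝ) 1, (1 - x ^ 2) ^ 2 * p x = t * (1 - (t - 1) * x ^ 2) :=
    fun x hx => by
      rw [hpdef, mul_div_cancel₀ _ (pow_ne_zero 2 (hw x hx).ne')]
  have hv : ∀ x ∈ Ioo (-1 : ℝ) 1, HasDerivAt (fun s : ℝ => (1 - s ^ 2) ^ (t / 2))
      (-t * x * (1 - x ^ 2) ^ (t / 2 - 1)) x := fun x hx => by
    refine (hasDerivAt_one_sub_sq_rpow (t / 2) hx).congr_deriv ?_
    ring
  have hv' : ∀ x ∈ Ioo (-1 : ℝ) 1,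
      HasDerivAt (fun s : ℝ => -t * s * (1 - s ^ 2) ^ (t / 2 - 1))
        (-(p x * (1 - x ^ 2) ^ (t / 2))) x := fun x hx => by
    have hx0 := hw x hx
    refine (((hasDerivAt_id' x).const_mul (-t)).fun_mul
      (hasDerivAt_one_sub_sq_rpow (t / 2 - 1) hx)).congr_deriv ?_
    simp only [hpdef, Real.rpow_sub_one hx0.ne']
    have := hx0.ne'
    field_simp
    ring
  have hv0 : ∀ x ∈ Ioo (-1 : ℝ) 1, (1 - x ^ 2) ^ (t / 2) ≠ 0 :=
    fun x hx => (Real.rpow_pos_of_pos (hw x hx) _).ne'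
  refine ⟨⟨?_, ?_, ?_, ?_, ?_⟩, ?_, hv, hv', hv0⟩
  · rw [funext hpdef]
    exact ContinuousOn.div (by fun_prop) (by fun_prop)
      fun x hx => pow_ne_zero 2 (hw x hx).ne'
  · intro x hx
    have hx0 := hw x hx
    rw [hpdef]
    have : 0 < 1 - (t - 1) * x ^ 2 := by nlinarith [sq_nonneg x]
    positivity
  · intro x _
    simp [hpdef]
  · intro x hx y hy hxy
    have hI : ∀ z ∈ Ico (0 : ℝ) 1, z ∈ Ioo (-1 : ℝ) 1 :=
      fun z hz => ⟨by linarith [hz.1], hz.2⟩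
    simp only [hwp x (hI x hx), hwp y (hI y hy)]
    have hsq : x ^ 2 ≤ y ^ 2 := pow_le_pow_left₀ hx.1 hxy 2
    gcongr
  · intro u u' hu hu' hne x₁ hx₁ x₂ hx₂ h₁ h₂
    exact eq_of_zeros_of_nonvanishing_solution hu hu' hv hv' hv0 hne hx₁ hx₂ h₁ h₂
  · have hcont : Continuous fun x : ℝ => t * (1 - (t - 1) * x ^ 2) := by fun_prop
    have hlim := hcont.tendsto 1
    rw [show t * (1 - (t - 1) * (1 : ℝ) ^ 2) = t * (2 - t) by ring] at hlim
    refine (hlim.mono_left nhdsWithin_le_nhds).congr' ?_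
    filter_upwards [self_mem_nhdsWithin] with x hx using (hwp x hx).symm
end
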